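/- arXiv:math/0702311 — 2 statements merged into one kernel-verified Lean document; each statement's English description precedes it below -/
import Mathlib

section
/- For every p ∈ ℝ there exist real numbers ã < b̃ and a C¹ path w : [ã,b̃] → ℝ³ which is g¹₃-timelike (i.e. (w₀'(t) + w₂(t)·w₁'(t))² > w₁'(t)² + w₂'(t)² for all t) and satisfies w(ã) = (p,0,0), w(b̃) = (0,0,0), and w'(ã) = w'(b̃) = (1,0,0). -/
open Set

/-- A `C¹` path `w = (w₀,w₁,w₂) : s → ℝ³` is `g^c₃`-timelike iff at every
`t ∈ s` its derivative `w'` satisfies `w'(t)ᵀ·G^c(w(t))·w'(t) < 0`,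
equivalently `c²·(w₀'(t) + w₂(t)·w₁'(t))² > w₁'(t)² + w₂'(t)²`. -/
def TimelikeOn (c : ℝ) (w₀ w₁ w₂ : ℝ → ℝ) (s : Set ℝ) : Prop :=
  ∀ t ∈ s,
    (derivWithin w₁ s t)^2 + (derivWithin w₂ s t)^2 <
      c^2 * (derivWithin w₀ s t + w₂ t * derivWithin w₁ s t)^2

/-- The plane loop `s ↦ (s²(1-s)², μ s²(1-s)²(1-2s))`, `s ∈ [0,1]`, has speed less than one when
`|μ| ≤ 1`. -/
theorem loop_speed_sq_lt_one {s μ : ℝ} (h0 : 0 ≤ s) (h1 : s ≤ 1) (hμ : μ ^ 2 ≤ 1) :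
    (2 * s * (1 - s) * (1 - 2 * s)) ^ 2 +
      (μ * (2 * (s * (1 - s)) - 10 * (s * (1 - s)) ^ 2)) ^ 2 < 1 := by
  obtain ⟨v, hv⟩ : ∃ v, v = s * (1 - s) := ⟨_, rfl⟩
  have hv0 : 0 ≤ v := hv ▸ mul_nonneg h0 (by linarith)
  have hv1 : v ≤ 1 / 4 := by nlinarith [sq_nonneg (1 - 2 * s)]
  have hf : (2 * s * (1 - s) * (1 - 2 * s)) ^ 2 = 4 * v ^ 2 * (1 - 4 * v) := by
    rw [hv]; ring
  have hf_le : 4 * v ^ 2 * (1 - 4 * v) ≤ 1 / 4 := by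
    nlinarith [mul_nonneg hv0 (sq_nonneg v), mul_nonneg hv0 (sub_nonneg.2 hv1)]
  have hg_le : (2 * v - 10 * v ^ 2) ^ 2 ≤ 1 / 4 := by
    rw [show (1 / 4 : ℝ) = (1 / 2) ^ 2 by norm_num]
    apply sq_le_sq'
    · nlinarith
    · nlinarith
  have hμg : μ ^ 2 * (2 * v - 10 * v ^ 2) ^ 2 ≤ 1 * (1 / 4) :=
    mul_le_mul hμ hg_le (sq_nonneg _) zero_le_one
  rw [hf, ← hv, mul_pow]
  linarith

/-- for every `p ∈ ℝ` there is a `g¹₃`-timelike `C¹` path from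
`(p,0,0)` to `(0,0,0)` whose derivative at both endpoints is `(1,0,0)`. -/
theorem stmt_10 (p : ℝ) :
    ∃ ta tb : ℝ, ta < tb ∧
      ∃ w₀ w₁ w₂ : ℝ → ℝ,
        ContDiffOn ℝ 1 w₀ (Icc ta tb) ∧
        ContDiffOn ℝ 1 w₁ (Icc ta tb) ∧
        ContDiffOn ℝ 1 w₂ (Icc ta tb) ∧
        TimelikeOn 1 w₀ w₁ w₂ (Icc ta tb) ∧
        w₀ ta = p ∧ w₁ ta = 0 ∧ w₂ ta = 0 ∧
        w₀ tb = 0 ∧ w₁ tb = 0 ∧ w₂ tb = 0 ∧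
        derivWithin w₀ (Icc ta tb) ta = 1 ∧
        derivWithin w₁ (Icc ta tb) ta = 0 ∧
        derivWithin w₂ (Icc ta tb) ta = 0 ∧
        derivWithin w₀ (Icc ta tb) tb = 1 ∧
        derivWithin w₁ (Icc ta tb) tb = 0 ∧
        derivWithin w₂ (Icc ta tb) tb = 0 := by
  obtain ⟨T, hT⟩ : ∃ T, T = 1260 + |p| := ⟨_, rfl⟩
  have hT0 : 0 < T := by rw [hT]; positivity
  have hTne : T ≠ 0 := hT0.ne'
  obtain ⟨μ, hμ⟩ : ∃ μ, μ = 630 * (p + T) / T ^ 2 := ⟨_, rfl⟩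
  have hμ1 : μ ^ 2 ≤ 1 := by
    have hp := neg_abs_le p
    have hp' := le_abs_self p
    have h0 : 0 ≤ μ := hμ ▸ div_nonneg (by linarith) (sq_nonneg T)
    have h1 : μ ≤ 1 := by
      rw [hμ, div_le_one (by positivity)]
      nlinarith [abs_nonneg p]
    exact pow_le_one₀ h0 h1
  have hs (t : ℝ) : HasDerivAt (fun t : ℝ => t / T) (1 / T) t := (hasDerivAt_id t).div_const T
  let w₀ : ℝ → ℝ := fun t => p + t - 2 * μ * T ^ 2 *
    ((t / T) ^ 4 / 4 - 7 * (t / T) ^ 5 / 5 + 19 * (t / T) ^ 6 / 6 - 25 * (t / T) ^ 7 / 7 +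
      2 * (t / T) ^ 8 - 4 * (t / T) ^ 9 / 9)
  let w₁ : ℝ → ℝ := fun t => T * ((t / T) ^ 2 * (1 - t / T) ^ 2)
  let w₂ : ℝ → ℝ := fun t => μ * T * ((t / T) ^ 2 * (1 - t / T) ^ 2 * (1 - 2 * (t / T)))
  have hd₀ (t : ℝ) : HasDerivAt w₀
      (1 - 2 * μ * T * ((t / T) ^ 3 * (1 - t / T) ^ 3 * (1 - 2 * (t / T)) ^ 2)) t := by
    have h := ((hasDerivAt_id t).const_add p).sub
      (((((((((hs t).pow 4).div_const 4).sub ((((hs t).pow 5).const_mul 7).div_const 5)).add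
        ((((hs t).pow 6).const_mul 19).div_const 6)).sub
        ((((hs t).pow 7).const_mul 25).div_const 7)).add (((hs t).pow 8).const_mul 2)).sub
        ((((hs t).pow 9).const_mul 4).div_const 9)).const_mul (2 * μ * T ^ 2))
    refine h.congr_deriv ?_
    norm_num
    field_simp
    ring
  have hd₁ (t : ℝ) : HasDerivAt w₁ (2 * (t / T) * (1 - t / T) * (1 - 2 * (t / T))) t := by
    have h := (((hs t).pow 2).mul (((hs t).const_sub 1).pow 2)).const_mul T
    refine h.congr_deriv ?_
    norm_num
    field_simp
    ring
  have hd₂ (t : ℝ) : HasDerivAt w₂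
      (μ * (2 * (t / T * (1 - t / T)) - 10 * (t / T * (1 - t / T)) ^ 2)) t := by
    have h := ((((hs t).pow 2).mul (((hs t).const_sub 1).pow 2)).mul
      (((hs t).const_mul 2).const_sub 1)).const_mul (μ * T)
    refine h.congr_deriv ?_
    norm_num
    field_simp
    ring
  have hu := uniqueDiffOn_Icc hT0
  have hl : (0 : ℝ) ∈ Icc 0 T := left_mem_Icc.2 hT0.le
  have hr : T ∈ Icc 0 T := right_mem_Icc.2 hT0.le
  have hw₀ {t : ℝ} (ht : t ∈ Icc 0 T) := (hd₀ t).hasDerivWithinAt.derivWithin (hu t ht)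
  have hw₁ {t : ℝ} (ht : t ∈ Icc 0 T) := (hd₁ t).hasDerivWithinAt.derivWithin (hu t ht)
  have hw₂ {t : ℝ} (ht : t ∈ Icc 0 T) := (hd₂ t).hasDerivWithinAt.derivWithin (hu t ht)
  refine ⟨0, T, hT0, w₀, w₁, w₂, ?_, ?_, ?_, ?_, ?_, ?_, ?_, ?_, ?_, ?_, ?_, ?_, ?_, ?_, ?_, ?_⟩
  · exact ContDiff.contDiffOn (by fun_prop)
  · exact ContDiff.contDiffOn (by fun_prop)
  · exact ContDiff.contDiffOn (by fun_prop)
  · intro t ht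
    rw [hw₀ ht, hw₁ ht, hw₂ ht]
    refine (loop_speed_sq_lt_one (div_nonneg ht.1 hT0.le) ((div_le_one hT0).2 ht.2) hμ1).trans_eq ?_
    simp only [w₂]
    ring
  · simp [w₀]
  · simp [w₁]
  · simp [w₂]
  · simp only [w₀, div_self hTne, hμ]
    field_simp
    ring
  · simp [w₁, div_self hTne]
  · simp [w₂, div_self hTne]
  · simp [hw₀ hl]
  · simp [hw₁ hl]
  · simp [hw₂ hl]
  · simp [hw₀ hr, div_self hTne]
  · simp [hw₁ hr, div_self hTne]
  · simp [hw₂ hr, div_self hTne]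
end

section
/- Let λ ∈ ℝ^r, v₀, s ∈ ℝ, and u, w ∈ ℝ^r, and assume v₀² ≥ ‖u‖² + ‖w‖² + s². Then 9·‖λ‖⁴·v₀² − Σ_{i=1}^{r} (2·λᵢ² − ‖λ‖²)²·(uᵢ² + wᵢ²) − ‖λ‖⁴·s² ≥ 8·‖λ‖⁴·v₀², where ‖λ‖² = Σᵢ λᵢ². -/
/-- the algebraic core of the semi-dominant energy niceness of
twisted spacelike distributions (Proposition 7.2): for a causal vector
`v = v₀e₀ + Σᵢ(uᵢeᵢ + wᵢe_{r+i}) + s·e_{2r+1}` (i.e. `v₀² ≥ ‖u‖² + ‖w‖² + s²`),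
`−g(♯β(v,·), ♯β(v,·)) = 9‖λ‖⁴v₀² − Σᵢ(2λᵢ² − ‖λ‖²)²(uᵢ² + wᵢ²) − ‖λ‖⁴s²
 ≥ 8‖λ‖⁴v₀²`. -/
theorem stmt_16 (r : ℕ) (lam u w : EuclideanSpace ℝ (Fin r)) (v₀ s : ℝ)
    (hcausal : v₀^2 ≥ ‖u‖^2 + ‖w‖^2 + s^2) :
    9 * ‖lam‖^4 * v₀^2
        - (∑ i : Fin r, (2 * lam i^2 - ‖lam‖^2)^2 * (u i^2 + w i^2))
        - ‖lam‖^4 * s^2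
      ≥ 8 * ‖lam‖^4 * v₀^2 := by
  have h_coeff (i : Fin r) : (2 * lam i^2 - ‖lam‖^2)^2 ≤ ‖lam‖^4 := by
    have h_le : lam i^2 ≤ ‖lam‖^2 := by
      rw [EuclideanSpace.real_norm_sq_eq]
      exact Finset.single_le_sum (f := fun j => lam j^2) (fun j _ => sq_nonneg _)
        (Finset.mem_univ i)
    nlinarith [mul_nonneg (sq_nonneg (lam i)) (sub_nonneg.2 h_le)]
  have h_sum : ∑ i : Fin r, (2 * lam i^2 - ‖lam‖^2)^2 * (u i^2 + w i^2)
      ≤ ‖lam‖^4 * (‖u‖^2 + ‖w‖^2) := by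
    rw [EuclideanSpace.real_norm_sq_eq u, EuclideanSpace.real_norm_sq_eq w,
      ← Finset.sum_add_distrib, Finset.mul_sum]
    exact Finset.sum_le_sum fun i _ => mul_le_mul_of_nonneg_right (h_coeff i) (by positivity)
  have h_mul := mul_le_mul_of_nonneg_left hcausal (by positivity : 0 ≤ ‖lam‖^4)
  linarith
end
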